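/- Let r ≥ 1, let γ_0,…,γ_{r−1} be partitions with total size |γ| := ∑_{i} |γ_i|, and let u_{i,n}, v_{i,m} be the associated monomials. Then the following identity of formal series holds: ∏_{i=0}^{r−1} ∏_{n,m>0} (1 − y t_2^{−1} u_{i,n} v_{i,m}) · ∏_{0≤i<j≤r−1} ∏_{n,m>0} [(1 − y t_2^{−1} u_{j,n} v_{i,m})(1 − y^{−1} t_1 u_{j,n} v_{i,m})] / [(1 − t_2^{−1} u_{j,n} v_{i,m})(1 − t_1 u_{j,n} v_{i,m})] = y^{(1−r)|γ|} · ∏_{0≤i<j≤r−1} [M(e_i e_j^{−1} t_1; t_1^{−1}, t_2) / M(y^{−1} e_i e_j^{−1} t_1; t_1^{−1}, t_2)] · [M(y e_j e_i^{−1} t_2^{−1}; t_1^{−1}, t_2) / M(e_j e_i^{−1} t_2^{−1}; t_1^{−1}, t_2)] · ∏_{i=0}^{r−1} ∏_{n,m>0} (1 − t_2^{−1} u_{i,n} v_{i,m}) · ∏_{i,j=0}^{r−1} ∏_{n,m>0} (1 − y t_2^{−1} u_{j,n} v_{i,m}) / (1 − t_2^{−1} u_{j,n} v_{i,m}). -/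

import Mathlib

/-!
STATEMENT 3.
The formal completion "in which `t₁⁻¹` and `t₂` have positive order" is realised as the
field of Hahn series `HahnSeries (ℤ ×ₗ ℤ) F` over a(n arbitrary) field `F`: the monomial
`t₁^a t₂^b` is the Hahn single supported at `(b − a, −a)`, so that `t₁⁻¹, t₂` have
positive order.  The invertible formal coefficient variables `y, e₀, …, e_{r−1}` are
arbitrary nonzero elements of `F`.  All infinite products over `n, m > 0` converge
coefficientwise; equality of the two sides is expressed by saying that, below any given
degree, the truncated products (over `1 ≤ n, m ≤ N`) of the two sides eventually agree.
-/

noncomputable section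

abbrev Γ2 : Type := ℤ ×ₗ ℤ

variable (F : Type*) [Field F]

/-- The monomial `t₁^a t₂^b`. -/
def mono (a b : ℤ) : HahnSeries Γ2 F := HahnSeries.single (toLex (b - a, -a)) 1

/-- `u_{i,n} = e_i⁻¹ t₁^{(γ'_i)ₙ} t₂^n` (here `n : ℕ` encodes the 1-indexed `n+1`). -/
def uMon {r : ℕ} (Pa : Fin r → YoungDiagram) (e : Fin r → F) (i : Fin r) (n : ℕ) :
    HahnSeries Γ2 F :=
  (HahnSeries.C (e i))⁻¹ * mono F ((Pa i).colLen n) (n + 1)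

/-- `v_{i,m} = e_i t₁^{−m} t₂^{−(γ_i)ₘ}` (here `m : ℕ` encodes the 1-indexed `m+1`). -/
def vMon {r : ℕ} (Pa : Fin r → YoungDiagram) (e : Fin r → F) (i : Fin r) (m : ℕ) :
    HahnSeries Γ2 F :=
  HahnSeries.C (e i) * mono F (-(m + 1)) (-(Pa i).rowLen m)

/-- Truncation (over `1 ≤ n, m ≤ N`) of the generalised MacMahon function
`M(K; t₁⁻¹, t₂) = ∏_{n,m>0} (1 − K t₁^{−n} t₂^m)⁻¹`. -/
def Mtr (K : HahnSeries Γ2 F) (N : ℕ) : HahnSeries Γ2 F :=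
  ∏ n ∈ Finset.range N, ∏ m ∈ Finset.range N, (1 - K * mono F (-(n + 1)) (m + 1))⁻¹

/-- Truncation of the left-hand side of Statement 3:
`∏_i ∏_{n,m>0} (1 − y t₂⁻¹ u_{i,n} v_{i,m})
  · ∏_{i<j} ∏_{n,m>0} (1 − y t₂⁻¹ u_{j,n} v_{i,m})(1 − y⁻¹ t₁ u_{j,n} v_{i,m})
      / ((1 − t₂⁻¹ u_{j,n} v_{i,m})(1 − t₁ u_{j,n} v_{i,m}))`. -/
def lhs3 {r : ℕ} (Pa : Fin r → YoungDiagram) (e : Fin r → F) (y : F) (N : ℕ) :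
    HahnSeries Γ2 F :=
  (∏ i : Fin r, ∏ n ∈ Finset.range N, ∏ m ∈ Finset.range N,
      (1 - HahnSeries.C y * mono F 0 (-1) * uMon F Pa e i n * vMon F Pa e i m)) *
  ∏ i : Fin r, ∏ j ∈ Finset.Ioi i, ∏ n ∈ Finset.range N, ∏ m ∈ Finset.range N,
    ((1 - HahnSeries.C y * mono F 0 (-1) * uMon F Pa e j n * vMon F Pa e i m) *
     (1 - (HahnSeries.C y)⁻¹ * mono F 1 0 * uMon F Pa e j n * vMon F Pa e i m)) /
    ((1 - mono F 0 (-1) * uMon F Pa e j n * vMon F Pa e i m) *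
     (1 - mono F 1 0 * uMon F Pa e j n * vMon F Pa e i m))

/-- Truncation of the right-hand side of Statement 3:
`y^{(1−r)|γ|}
  · ∏_{i<j} [M(e_i e_j⁻¹ t₁)/M(y⁻¹ e_i e_j⁻¹ t₁)] · [M(y e_j e_i⁻¹ t₂⁻¹)/M(e_j e_i⁻¹ t₂⁻¹)]
  · ∏_i ∏_{n,m>0} (1 − t₂⁻¹ u_{i,n} v_{i,m})
  · ∏_{i,j} ∏_{n,m>0} (1 − y t₂⁻¹ u_{j,n} v_{i,m})/(1 − t₂⁻¹ u_{j,n} v_{i,m})`. -/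
def rhs3 {r : ℕ} (Pa : Fin r → YoungDiagram) (e : Fin r → F) (y : F) (N : ℕ) :
    HahnSeries Γ2 F :=
  HahnSeries.C y ^ ((1 - (r : ℤ)) * ∑ i : Fin r, ((Pa i).cells.card : ℤ)) *
  (∏ i : Fin r, ∏ j ∈ Finset.Ioi i,
    (Mtr F (HahnSeries.C (e i) * (HahnSeries.C (e j))⁻¹ * mono F 1 0) N /
      Mtr F ((HahnSeries.C y)⁻¹ * HahnSeries.C (e i) * (HahnSeries.C (e j))⁻¹ *
        mono F 1 0) N) *
    (Mtr F (HahnSeries.C y * HahnSeries.C (e j) * (HahnSeries.C (e i))⁻¹ *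
        mono F 0 (-1)) N /
      Mtr F (HahnSeries.C (e j) * (HahnSeries.C (e i))⁻¹ * mono F 0 (-1)) N)) *
  (∏ i : Fin r, ∏ n ∈ Finset.range N, ∏ m ∈ Finset.range N,
      (1 - mono F 0 (-1) * uMon F Pa e i n * vMon F Pa e i m)) *
  ∏ i : Fin r, ∏ j : Fin r, ∏ n ∈ Finset.range N, ∏ m ∈ Finset.range N,
    (1 - HahnSeries.C y * mono F 0 (-1) * uMon F Pa e j n * vMon F Pa e i m) /
    (1 - mono F 0 (-1) * uMon F Pa e j n * vMon F Pa e i m)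

section comb
variable {R : Type*} [CommRing R]

lemma cells_sum_col {M : Type*} [AddCommMonoid M] (μ : YoungDiagram) (N : ℕ)
    (hN : ∀ x ∈ μ.cells, x.1 < N ∧ x.2 < N) (f : ℕ → ℕ → M) :
    ∑ x ∈ μ.cells, f x.1 x.2 = ∑ n ∈ Finset.range N, ∑ m ∈ Finset.range (μ.colLen n), f m n := by
  have h1 : μ.cells = (Finset.range N ×ˢ Finset.range N).filter (· ∈ μ.cells) := by
    ext x
    simp only [Finset.mem_filter, Finset.mem_product, Finset.mem_range]
    exact ⟨fun h => ⟨hN x h, h⟩, fun h => h.2⟩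
  rw [h1, Finset.sum_filter, Finset.sum_product_right]
  refine Finset.sum_congr rfl fun n _ => ?_
  rw [← Finset.sum_filter]
  refine Finset.sum_congr ?_ fun _ _ => rfl
  ext m
  simp only [Finset.mem_filter, Finset.mem_range, YoungDiagram.mem_cells,
    YoungDiagram.mem_iff_lt_colLen]
  refine ⟨fun h => h.2, fun h => ⟨?_, h⟩⟩
  exact (hN (m, n) (by rwa [YoungDiagram.mem_cells, YoungDiagram.mem_iff_lt_colLen])).1

lemma cells_sum_row {M : Type*} [AddCommMonoid M] (μ : YoungDiagram) (N : ℕ)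
    (hN : ∀ x ∈ μ.cells, x.1 < N ∧ x.2 < N) (f : ℕ → ℕ → M) :
    ∑ x ∈ μ.cells, f x.1 x.2 = ∑ m ∈ Finset.range N, ∑ n ∈ Finset.range (μ.rowLen m), f m n := by
  have h1 : μ.cells = (Finset.range N ×ˢ Finset.range N).filter (· ∈ μ.cells) := by
    ext x
    simp only [Finset.mem_filter, Finset.mem_product, Finset.mem_range]
    exact ⟨fun h => ⟨hN x h, h⟩, fun h => h.2⟩
  rw [h1, Finset.sum_filter, Finset.sum_product]
  refine Finset.sum_congr rfl fun m _ => ?_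
  rw [← Finset.sum_filter]
  refine Finset.sum_congr ?_ fun _ _ => rfl
  ext n
  simp only [Finset.mem_filter, Finset.mem_range, YoungDiagram.mem_cells,
    YoungDiagram.mem_iff_lt_rowLen]
  refine ⟨fun h => h.2, fun h => ⟨?_, h⟩⟩
  exact (hN (m, n) (by rwa [YoungDiagram.mem_cells, YoungDiagram.mem_iff_lt_rowLen])).2

lemma col_gen (μ : YoungDiagram) (N : ℕ)
    (hN : ∀ x ∈ μ.cells, x.1 < N ∧ x.2 < N) (a b : R) :
    ∑ n ∈ Finset.range N, a ^ μ.colLen n * b ^ n =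
      ∑ n ∈ Finset.range N, b ^ n - (1 - a) * ∑ x ∈ μ.cells, a ^ x.1 * b ^ x.2 := by
  rw [cells_sum_col μ N hN (fun m n => a ^ m * b ^ n), Finset.mul_sum, ← Finset.sum_sub_distrib]
  refine Finset.sum_congr rfl fun n _ => ?_
  rw [← Finset.sum_mul, ← mul_assoc, mul_neg_geom_sum]
  ring

lemma row_gen (μ : YoungDiagram) (N : ℕ)
    (hN : ∀ x ∈ μ.cells, x.1 < N ∧ x.2 < N) (a b : R) :
    ∑ m ∈ Finset.range N, a ^ m * b ^ μ.rowLen m =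
      ∑ m ∈ Finset.range N, a ^ m - (1 - b) * ∑ x ∈ μ.cells, a ^ x.1 * b ^ x.2 := by
  rw [cells_sum_row μ N hN (fun m n => a ^ m * b ^ n), Finset.mul_sum, ← Finset.sum_sub_distrib]
  refine Finset.sum_congr rfl fun n _ => ?_
  rw [← Finset.mul_sum, mul_left_comm, mul_neg_geom_sum]
  ring

lemma ring_identity (μ ν : YoungDiagram) (N : ℕ)
    (hμ : ∀ x ∈ μ.cells, x.1 < N ∧ x.2 < N) (hν : ∀ x ∈ ν.cells, x.1 < N ∧ x.2 < N)
    (a a' b b' : R) (ha : a * a' = 1) (hb : b * b' = 1) :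
    b' * ((∑ n ∈ Finset.range N, a' ^ ν.colLen n * b' ^ n) *
        (∑ m ∈ Finset.range N, a ^ m * b ^ μ.rowLen m)) +
      a' * ((∑ n ∈ Finset.range N, a' ^ n) * (∑ m ∈ Finset.range N, b ^ m)) +
      b' ^ N * (∑ x ∈ μ.cells, a ^ x.1 * b ^ x.2) +
      a' * b' * a ^ N * (∑ x ∈ ν.cells, a' ^ x.1 * b' ^ x.2) =
    b' * ((∑ n ∈ Finset.range N, a ^ n) * (∑ m ∈ Finset.range N, b' ^ m)) +
      a' * ((∑ n ∈ Finset.range N, a ^ μ.colLen n * b ^ n) *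
        (∑ m ∈ Finset.range N, a' ^ m * b' ^ ν.rowLen m)) +
      a' * b' * b ^ N * (∑ x ∈ ν.cells, a' ^ x.1 * b' ^ x.2) +
      a' ^ N * (∑ x ∈ μ.cells, a ^ x.1 * b ^ x.2) := by
  rw [col_gen ν N hν a' b', row_gen μ N hμ a b, col_gen μ N hμ a b, row_gen ν N hν a' b']
  have h1 := mul_neg_geom_sum a N
  have h2 := mul_neg_geom_sum a' N
  have h3 := mul_neg_geom_sum b N
  have h4 := mul_neg_geom_sum b' N
  generalize (∑ n ∈ Finset.range N, a ^ n) = A at *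
  generalize (∑ n ∈ Finset.range N, a' ^ n) = A' at *
  generalize (∑ n ∈ Finset.range N, b ^ n) = B at *
  generalize (∑ n ∈ Finset.range N, b' ^ n) = B' at *
  generalize (∑ x ∈ μ.cells, a ^ x.1 * b ^ x.2) = Q at *
  generalize (∑ x ∈ ν.cells, a' ^ x.1 * b' ^ x.2) = P at *
  linear_combination (Q * h4 - Q * h2) + a' * b' * P * (h1 - h3) + (b' * A * P + (-Q) * A' + (1-b') * P * Q) * ha + (-(a' * B * P) + Q * B' - (1 - a') * P * Q) * hb

/-- exponents -/
lemma hom_identity (μ ν : YoungDiagram) (N : ℕ)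
    (hμ : ∀ x ∈ μ.cells, x.1 < N ∧ x.2 < N) (hν : ∀ x ∈ ν.cells, x.1 < N ∧ x.2 < N)
    {β : Type*} [AddCommGroup β] (φ : ℤ → ℤ → β) :
    (∑ n ∈ Finset.range N, ∑ m ∈ Finset.range N,
        φ ((m : ℤ) - ν.colLen n) ((μ.rowLen m : ℤ) - n - 1)) +
      (∑ n ∈ Finset.range N, ∑ m ∈ Finset.range N, φ (-((n : ℤ) + 1)) m) +
      (∑ x ∈ μ.cells, φ x.1 ((x.2 : ℤ) - N)) +
      (∑ x ∈ ν.cells, φ ((N : ℤ) - 1 - x.1) (-1 - (x.2 : ℤ))) =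
    (∑ n ∈ Finset.range N, ∑ m ∈ Finset.range N, φ n (-((m : ℤ) + 1))) +
      (∑ n ∈ Finset.range N, ∑ m ∈ Finset.range N,
        φ ((μ.colLen n : ℤ) - m - 1) ((n : ℤ) - ν.rowLen m)) +
      (∑ x ∈ ν.cells, φ (-1 - (x.1 : ℤ)) ((N : ℤ) - 1 - x.2)) +
      (∑ x ∈ μ.cells, φ ((x.1 : ℤ) - N) x.2) := by
  let T : ℤ → ℤ → FreeAbelianGroup (Multiplicative (ℤ × ℤ)) :=
    fun p q => FreeAbelianGroup.of (Multiplicative.ofAdd (p, q))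
  let G : FreeAbelianGroup (Multiplicative (ℤ × ℤ)) →+ β :=
    FreeAbelianGroup.lift fun w => φ w.toAdd.1 w.toAdd.2
  have hG : ∀ p q, φ p q = G (T p q) := by
    intro p q
    simp [G, T]
  have hT : ∀ p q p' q', T p q * T p' q' = T (p + p') (q + q') := by
    intro p q p' q'
    simp only [T, FreeAbelianGroup.of_mul_of]
    rfl
  have hT1 : T 0 0 = 1 := rfl
  have hTp : ∀ p q (k : ℕ), T p q ^ k = T (k * p) (k * q) := by
    intro p q k
    induction k with
    | zero => simp [hT1]
    | succ k ih =>
      rw [pow_succ, ih, hT]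
      congr 1 <;> push_cast <;> ring
  have key := congrArg G (ring_identity μ ν N hμ hν (T 1 0) (T (-1) 0) (T 0 1) (T 0 (-1))
    (by rw [hT]; exact hT1) (by rw [hT]; exact hT1))
  simp only [Finset.sum_mul_sum] at key
  simp only [Finset.mul_sum, hTp, hT, map_add, map_sum, ← hG] at key
  convert key using 1
  · congr 1
    · congr 1
      · congr 1
        all_goals
          refine Finset.sum_congr rfl fun n _ => Finset.sum_congr rfl fun m _ => ?_
          congr 1 <;> ring
      · refine Finset.sum_congr rfl fun n _ => ?_
        congr 1 <;> ring
    · refine Finset.sum_congr rfl fun n _ => ?_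
      congr 1 <;> ring
  · congr 1
    · congr 1
      · congr 1
        all_goals
          refine Finset.sum_congr rfl fun n _ => Finset.sum_congr rfl fun m _ => ?_
          congr 1 <;> ring
      · refine Finset.sum_congr rfl fun n _ => ?_
        congr 1 <;> ring
    · refine Finset.sum_congr rfl fun n _ => ?_
      congr 1 <;> ring
end comb

section val
variable {F}

def PD (d : ℤ) (X : HahnSeries Γ2 F) : Prop := ∀ g : Γ2, (ofLex g).1 < d → X.coeff g = 0

lemma PD.mono' {d d' : ℤ} {X : HahnSeries Γ2 F} (h : PD d X) (hd : d' ≤ d) : PD d' X :=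
  fun g hg => h g (lt_of_lt_of_le hg hd)

lemma PD.add {d : ℤ} {X Y : HahnSeries Γ2 F} (hX : PD d X) (hY : PD d Y) : PD d (X + Y) := by
  intro g hg
  rw [HahnSeries.coeff_add, hX g hg, hY g hg, add_zero]

lemma PD.neg {d : ℤ} {X : HahnSeries Γ2 F} (hX : PD d X) : PD d (-X) := by
  intro g hg
  rw [HahnSeries.coeff_neg, hX g hg, neg_zero]

lemma PD.mul {d d' : ℤ} {X Y : HahnSeries Γ2 F} (hX : PD d X) (hY : PD d' Y) :
    PD (d + d') (X * Y) := by
  intro g hg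
  rw [HahnSeries.coeff_mul]
  refine Finset.sum_eq_zero fun x hx => ?_
  have hx' := (Finset.mem_antidiagonal.1 hx).2.2
  have h1 : (ofLex x.1).1 + (ofLex x.2).1 = (ofLex g).1 := by rw [← hx']; rfl
  by_cases h : (ofLex x.1).1 < d
  · rw [hX _ h, zero_mul]
  · rw [hY x.2 (by omega), mul_zero]

lemma PD_one : PD 0 (1 : HahnSeries Γ2 F) := by
  intro g hg
  rw [HahnSeries.coeff_one, if_neg]
  rintro rfl
  exact lt_irrefl _ hg

lemma PD_exists (X : HahnSeries Γ2 F) : ∃ c : ℕ, PD (-(c : ℤ)) X := by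
  refine ⟨((ofLex X.order).1).natAbs, fun g hg => ?_⟩
  apply HahnSeries.coeff_eq_zero_of_lt_order
  rw [Prod.Lex.lt_iff]
  left
  omega

def UD (d : ℤ) (X : HahnSeries Γ2 F) : Prop := PD d (X - 1)

lemma UD_one (d : ℤ) : UD d (1 : HahnSeries Γ2 F) := by
  intro g _
  simp

lemma UD.PD0 {d : ℤ} (hd : 0 ≤ d) {X : HahnSeries Γ2 F} (h : UD d X) : PD 0 X := by
  have := (PD.mono' h hd).add PD_one
  simpa using this

lemma UD.mul {d : ℤ} (hd : 0 ≤ d) {X Y : HahnSeries Γ2 F} (hX : UD d X) (hY : UD d Y) :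
    UD d (X * Y) := by
  have h : X * Y - 1 = (X - 1) * Y + (Y - 1) := by ring
  unfold UD
  rw [h]
  refine PD.add ?_ hY
  simpa using PD.mul hX (hY.PD0 hd)

lemma UD.ne {d : ℤ} (hd : 1 ≤ d) {X : HahnSeries Γ2 F} (hX : UD d X) : X ≠ 0 := by
  rintro rfl
  have := hX 0 (show (0 : ℤ) < d by omega)
  simp at this

lemma UD.order {d : ℤ} (hd : 1 ≤ d) {X : HahnSeries Γ2 F} (hX : UD d X) : X.order = 0 := by
  have h0 : X.coeff 0 = 1 := by
    have := hX 0 (show (0 : ℤ) < d by omega)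
    simpa [sub_eq_zero] using this
  apply le_antisymm
  · exact HahnSeries.order_le_of_coeff_ne_zero (by rw [h0]; exact one_ne_zero)
  · rw [HahnSeries.le_order_iff_forall (hX.ne hd)]
    intro g hg
    have h1 : (ofLex g).1 < d := by
      rw [Prod.Lex.lt_iff] at hg
      have : (ofLex (0 : Γ2)).1 = 0 := rfl
      rcases hg with h | h <;> omega
    have := hX g h1
    rw [HahnSeries.coeff_sub, HahnSeries.coeff_one, if_neg hg.ne] at this
    simpa using this

lemma UD.inv {d : ℤ} (hd : 1 ≤ d) {X : HahnSeries Γ2 F} (hX : UD d X) : UD d X⁻¹ := by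
  have hne := hX.ne hd
  have h0 : PD 0 X⁻¹ := by
    intro g hg
    apply HahnSeries.coeff_eq_zero_of_lt_order
    have h1 := HahnSeries.order_mul hne (inv_ne_zero hne)
    rw [mul_inv_cancel₀ hne, HahnSeries.order_one, hX.order hd, zero_add] at h1
    rw [← h1, Prod.Lex.lt_iff]
    left
    exact hg
  have h : X⁻¹ - 1 = -((X - 1) * X⁻¹) := by field_simp; ring
  unfold UD
  rw [h]
  simpa using (PD.mul hX h0).neg

lemma UD.prod {d : ℤ} (hd : 0 ≤ d) {ι : Type*} (s : Finset ι) (f : ι → HahnSeries Γ2 F)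
    (h : ∀ i ∈ s, UD d (f i)) : UD d (∏ i ∈ s, f i) :=
  Finset.prod_induction f (UD d) (fun _ _ => UD.mul hd) (UD_one d) h

/-- uniformly bounded below -/
def BB (X : ℕ → HahnSeries Γ2 F) : Prop := ∃ c : ℕ, ∀ N, PD (-(c : ℤ)) (X N)

lemma BB.mul {X Y : ℕ → HahnSeries Γ2 F} (hX : BB X) (hY : BB Y) : BB (fun N => X N * Y N) := by
  obtain ⟨c, hc⟩ := hX
  obtain ⟨c', hc'⟩ := hY
  exact ⟨c + c', fun N => ((hc N).mul (hc' N)).mono' (by push_cast; omega)⟩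

lemma BB.prod {ι : Type*} (s : Finset ι) (f : ι → ℕ → HahnSeries Γ2 F)
    (h : ∀ i ∈ s, BB (f i)) : BB (fun N => ∏ i ∈ s, f i N) := by
  classical
  induction s using Finset.induction_on with
  | empty => exact ⟨0, fun N => by simpa using PD_one⟩
  | insert a s ha ih =>
    simp only [Finset.prod_insert ha]
    exact (h a (by simp)).mul (ih fun i hi => h i (by simp [hi]))

lemma PD.prod {ι : Type*} (s : Finset ι) (f : ι → HahnSeries Γ2 F) (c : ι → ℕ)
    (h : ∀ i ∈ s, PD (-(c i : ℤ)) (f i)) : PD (-((∑ i ∈ s, c i : ℕ) : ℤ)) (∏ i ∈ s, f i) := by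
  classical
  induction s using Finset.induction_on with
  | empty => simpa using PD_one
  | insert a s ha ih =>
    rw [Finset.prod_insert ha, Finset.sum_insert ha]
    exact ((h a (by simp)).mul (ih fun i hi => h i (by simp [hi]))).mono' (by push_cast; omega)

lemma BB_dbl (f : ℕ → ℕ → HahnSeries Γ2 F) (K : ℕ) (h : ∀ n m, K ≤ n + m → UD 1 (f n m)) :
    BB (fun N => ∏ n ∈ Finset.range N, ∏ m ∈ Finset.range N, f n m) := by
  choose c hc using fun n m => PD_exists (f n m)
  let c' : ℕ × ℕ → ℕ := fun x => if K ≤ x.1 + x.2 then 0 else c x.1 x.2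
  have hc' : ∀ x : ℕ × ℕ, PD (-(c' x : ℤ)) (f x.1 x.2) := by
    intro x
    by_cases hx : K ≤ x.1 + x.2
    · simpa [c', hx] using (h _ _ hx).PD0 zero_le_one
    · simpa [c', hx] using hc x.1 x.2
  refine ⟨∑ x ∈ Finset.range K ×ˢ Finset.range K, c' x, fun N => ?_⟩
  beta_reduce
  rw [← Finset.prod_product' (Finset.range N) (Finset.range N) f]
  refine (PD.prod _ _ c' (fun x _ => hc' x)).mono' ?_
  rw [neg_le_neg_iff, Nat.cast_le]
  rw [← Finset.sum_filter_of_ne (p := fun x => x ∈ Finset.range K ×ˢ Finset.range K)]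
  · apply Finset.sum_le_sum_of_subset
    intro x hx
    exact (Finset.mem_filter.1 hx).2
  · intro x _ hx
    have : ¬ K ≤ x.1 + x.2 := fun hh => hx (by simp [c', hh])
    simp only [Finset.mem_product, Finset.mem_range]
    omega

/-- the basic factor -/
def TT (c : F) (p q : ℤ) : HahnSeries Γ2 F := 1 - HahnSeries.C c * mono F p q

lemma mono_mul (p q p' q' : ℤ) : mono F p q * mono F p' q' = mono F (p + p') (q + q') := by
  simp only [mono, HahnSeries.single_mul_single, one_mul]
  have h : toLex (q - p, -p) + toLex (q' - p', -p') = toLex (q + q' - (p + p'), -(p + p')) := by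
    rw [← toLex_add]
    apply congrArg toLex
    ext <;> simp <;> ring
  rw [h]

lemma mono_zero : mono F 0 0 = 1 := rfl

lemma mono_ne (p q : ℤ) : mono F p q ≠ 0 := by
  intro h
  have := mono_mul (F := F) p q (-p) (-q)
  rw [h, zero_mul, add_neg_cancel, add_neg_cancel, mono_zero] at this
  exact zero_ne_one this

lemma mono_inv (p q : ℤ) : mono F (-p) (-q) = (mono F p q)⁻¹ := by
  apply eq_inv_of_mul_eq_one_left
  rw [mono_mul, neg_add_cancel, neg_add_cancel, mono_zero]

lemma TT_UD (c : F) (p q d : ℤ) (h : d ≤ q - p) : UD d (TT c p q) := by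
  intro g hg
  rw [TT, sub_sub_cancel_left, HahnSeries.coeff_neg, HahnSeries.C_mul_eq_smul,
    HahnSeries.coeff_smul, mono, HahnSeries.coeff_single_of_ne, smul_zero, neg_zero]
  rintro rfl
  simp at hg
  omega

lemma TT_eq_zero (c : F) (p q : ℤ) : TT c p q = 0 ↔ p = 0 ∧ q = 0 ∧ c = 1 := by
  constructor
  · intro h
    rw [TT, sub_eq_zero, mono, HahnSeries.C_mul_eq_smul] at h
    have h0 := congrArg (fun X => HahnSeries.coeff X 0) h
    simp only [HahnSeries.coeff_one, HahnSeries.coeff_smul, if_true,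
      HahnSeries.coeff_single, smul_eq_mul] at h0
    by_cases hz : (0 : Γ2) = toLex (q - p, -p)
    · rw [if_pos hz] at h0
      have h1 : (0 : ℤ) = q - p := congrArg (fun g : Γ2 => (ofLex g).1) hz
      have h2 : (0 : ℤ) = - p := congrArg (fun g : Γ2 => (ofLex g).2) hz
      refine ⟨by omega, by omega, by simpa using h0.symm⟩
    · rw [if_neg hz] at h0
      simp at h0
  · rintro ⟨rfl, rfl, rfl⟩
    simp [TT, mono_zero]

/-- g' -/
def gg (y κ : F) (p q : ℤ) : HahnSeries Γ2 F := TT (y * κ) p q / TT κ p q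

lemma gg_flip (y κ : F) (hy : y ≠ 0) (hκ : κ ≠ 0) (p q : ℤ) :
    TT (y⁻¹ * κ⁻¹) p q / TT κ⁻¹ p q = HahnSeries.C y⁻¹ * gg y κ (-p) (-q) := by
  unfold gg TT
  rw [mono_inv, map_mul, map_mul, map_inv₀, map_inv₀]
  have h1 : (HahnSeries.C y : HahnSeries Γ2 F) ≠ 0 := HahnSeries.C_ne_zero hy
  have h2 : (HahnSeries.C κ : HahnSeries Γ2 F) ≠ 0 := HahnSeries.C_ne_zero hκ
  have h3 := mono_ne (F := F) p q
  generalize (HahnSeries.C y : HahnSeries Γ2 F) = Y at *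
  generalize (HahnSeries.C κ : HahnSeries Γ2 F) = k at *
  generalize mono F p q = w at *
  have hX : -(k⁻¹ * w) ≠ 0 := neg_ne_zero.2 (mul_ne_zero (inv_ne_zero h2) h3)
  rw [← mul_div_mul_left (1 - Y * k * w⁻¹) _ hX, ← mul_div_assoc]
  congr 1
  · field_simp
    ring
  · field_simp
    ring

lemma gg_UD (y κ : F) (p q d : ℤ) (hd : 1 ≤ d) (h : d ≤ q - p) : UD d (gg y κ p q) := by
  unfold gg
  rw [div_eq_mul_inv]
  exact (TT_UD _ p q d h).mul (by omega) ((TT_UD _ p q d h).inv hd)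

lemma gg_UD' (y κ : F) (hy : y ≠ 0) (hκ : κ ≠ 0) (p q d : ℤ) (hd : 1 ≤ d) (h : d ≤ p - q) :
    UD d (HahnSeries.C y⁻¹ * gg y κ p q) := by
  have := gg_flip y κ hy hκ (-p) (-q)
  rw [neg_neg, neg_neg] at this
  rw [← this, div_eq_mul_inv]
  exact (TT_UD _ _ _ d (by omega)).mul (by omega) ((TT_UD _ _ _ d (by omega)).inv hd)

lemma gg_eq_zero (y κ : F) (p q : ℤ) :
    gg y κ p q = 0 ↔ p = 0 ∧ q = 0 ∧ (y * κ = 1 ∨ κ = 1) := by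
  unfold gg
  rw [div_eq_zero_iff, TT_eq_zero, TT_eq_zero]
  tauto
end val

section pair
variable {F}

lemma zero_count (μ ν : YoungDiagram) (N : ℕ)
    (hμ : ∀ x ∈ μ.cells, x.1 < N ∧ x.2 < N) (hν : ∀ x ∈ ν.cells, x.1 < N ∧ x.2 < N) :
    (∃ n ∈ Finset.range N, ∃ m ∈ Finset.range N,
      (m : ℤ) - ν.colLen n = 0 ∧ (μ.rowLen m : ℤ) - n - 1 = 0) ↔
    (∃ n ∈ Finset.range N, ∃ m ∈ Finset.range N,
      (μ.colLen n : ℤ) - m - 1 = 0 ∧ (n : ℤ) - ν.rowLen m = 0) := by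
  have key := hom_identity μ ν N hμ hν (β := ℤ) (fun p q => if p = 0 ∧ q = 0 then 1 else 0)
  have z1 : (∑ n ∈ Finset.range N, ∑ m ∈ Finset.range N,
      if (-((n : ℤ) + 1)) = 0 ∧ (m : ℤ) = 0 then (1 : ℤ) else 0) = 0 :=
    Finset.sum_eq_zero fun n _ => Finset.sum_eq_zero fun m _ => if_neg (by omega)
  have z2 : (∑ n ∈ Finset.range N, ∑ m ∈ Finset.range N,
      if (n : ℤ) = 0 ∧ (-((m : ℤ) + 1)) = 0 then (1 : ℤ) else 0) = 0 :=
    Finset.sum_eq_zero fun n _ => Finset.sum_eq_zero fun m _ => if_neg (by omega)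
  have z3 : (∑ x ∈ μ.cells, if (x.1 : ℤ) = 0 ∧ (x.2 : ℤ) - N = 0 then (1 : ℤ) else 0) = 0 :=
    Finset.sum_eq_zero fun x hx => if_neg (by have := hμ x hx; omega)
  have z4 : (∑ x ∈ ν.cells, if (N : ℤ) - 1 - x.1 = 0 ∧ -1 - (x.2 : ℤ) = 0 then (1 : ℤ) else 0) = 0 :=
    Finset.sum_eq_zero fun x hx => if_neg (by have := hν x hx; omega)
  have z5 : (∑ x ∈ ν.cells, if -1 - (x.1 : ℤ) = 0 ∧ (N : ℤ) - 1 - x.2 = 0 then (1 : ℤ) else 0) = 0 :=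
    Finset.sum_eq_zero fun x hx => if_neg (by have := hν x hx; omega)
  have z6 : (∑ x ∈ μ.cells, if (x.1 : ℤ) - N = 0 ∧ (x.2 : ℤ) = 0 then (1 : ℤ) else 0) = 0 :=
    Finset.sum_eq_zero fun x hx => if_neg (by have := hμ x hx; omega)
  rw [z1, z2, z3, z4, z5, z6] at key
  simp only [add_zero, zero_add] at key
  have pos : ∀ f g : ℕ → ℕ → ℤ, (∃ n ∈ Finset.range N, ∃ m ∈ Finset.range N, f n m = 0 ∧ g n m = 0)
      ↔ (∑ n ∈ Finset.range N, ∑ m ∈ Finset.range N,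
        if f n m = 0 ∧ g n m = 0 then (1 : ℤ) else 0) ≠ 0 := by
    intro f g
    have hnn : ∀ n m, (0 : ℤ) ≤ if f n m = 0 ∧ g n m = 0 then (1 : ℤ) else 0 := by
      intro n m
      split_ifs <;> simp
    rw [Ne, Finset.sum_eq_zero_iff_of_nonneg (fun n _ => Finset.sum_nonneg fun m _ => hnn n m)]
    simp only [Finset.sum_eq_zero_iff_of_nonneg (fun m _ => hnn _ m)]
    push Not
    simp only [ne_eq, ite_eq_right_iff, one_ne_zero, imp_false, not_not]
  rw [pos (fun n m => (m : ℤ) - ν.colLen n) (fun n m => (μ.rowLen m : ℤ) - n - 1),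
    pos (fun n m => (μ.colLen n : ℤ) - m - 1) (fun n m => (n : ℤ) - ν.rowLen m), key]

lemma cells_bound (μ : YoungDiagram) : ∃ M : ℕ, ∀ x ∈ μ.cells, x.1 < M ∧ x.2 < M := by
  refine ⟨∑ x ∈ μ.cells, (x.1 + x.2) + 1, fun x hx => ?_⟩
  have := Finset.single_le_sum (f := fun x : ℕ × ℕ => x.1 + x.2) (fun _ _ => Nat.zero_le _) hx
  omega

lemma prod_id {K : Type*} [Field K] (h : ℤ → ℤ → K) (N : ℕ) (μ ν : YoungDiagram)
    (hμ : ∀ x ∈ μ.cells, x.1 < N ∧ x.2 < N) (hν : ∀ x ∈ ν.cells, x.1 < N ∧ x.2 < N)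
    (hh : ∀ p q, h p q = 0 → p = 0 ∧ q = 0) :
    (∏ n ∈ Finset.range N, ∏ m ∈ Finset.range N,
        h ((m : ℤ) - ν.colLen n) ((μ.rowLen m : ℤ) - n - 1)) *
      (∏ n ∈ Finset.range N, ∏ m ∈ Finset.range N, h (-((n : ℤ) + 1)) m) *
      (∏ x ∈ μ.cells, h x.1 ((x.2 : ℤ) - N)) *
      (∏ x ∈ ν.cells, h ((N : ℤ) - 1 - x.1) (-1 - (x.2 : ℤ))) =
    (∏ n ∈ Finset.range N, ∏ m ∈ Finset.range N, h n (-((m : ℤ) + 1))) *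
      (∏ n ∈ Finset.range N, ∏ m ∈ Finset.range N,
        h ((μ.colLen n : ℤ) - m - 1) ((n : ℤ) - ν.rowLen m)) *
      (∏ x ∈ ν.cells, h (-1 - (x.1 : ℤ)) ((N : ℤ) - 1 - x.2)) *
      (∏ x ∈ μ.cells, h ((x.1 : ℤ) - N) x.2) := by
  classical
  by_cases hz : h 0 0 = 0 ∧ (∃ n ∈ Finset.range N, ∃ m ∈ Finset.range N,
      (m : ℤ) - ν.colLen n = 0 ∧ (μ.rowLen m : ℤ) - n - 1 = 0)
  · obtain ⟨hb, h1⟩ := hz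
    have h2 := (zero_count μ ν N hμ hν).1 h1
    obtain ⟨n, hn, m, hm, h1⟩ := h1
    obtain ⟨n', hn', m', hm', h2⟩ := h2
    have A : (∏ n ∈ Finset.range N, ∏ m ∈ Finset.range N,
        h ((m : ℤ) - ν.colLen n) ((μ.rowLen m : ℤ) - n - 1)) = 0 :=
      Finset.prod_eq_zero hn (Finset.prod_eq_zero hm (by rw [h1.1, h1.2, hb]))
    have B : (∏ n ∈ Finset.range N, ∏ m ∈ Finset.range N,
        h ((μ.colLen n : ℤ) - m - 1) ((n : ℤ) - ν.rowLen m)) = 0 :=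
      Finset.prod_eq_zero hn' (Finset.prod_eq_zero hm' (by rw [h2.1, h2.2, hb]))
    rw [A, B]
    ring
  have h1 : ∀ n ∈ Finset.range N, ∀ m ∈ Finset.range N,
      h ((m : ℤ) - ν.colLen n) ((μ.rowLen m : ℤ) - n - 1) ≠ 0 := by
    intro n hn m hm h0
    have h3 := hh _ _ h0
    exact hz ⟨by rwa [h3.1, h3.2] at h0, n, hn, m, hm, h3⟩
  have h2 : ∀ n ∈ Finset.range N, ∀ m ∈ Finset.range N,
      h ((μ.colLen n : ℤ) - m - 1) ((n : ℤ) - ν.rowLen m) ≠ 0 := by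
    intro n hn m hm h0
    have h3 := hh _ _ h0
    exact hz ⟨by rwa [h3.1, h3.2] at h0, (zero_count μ ν N hμ hν).2 ⟨n, hn, m, hm, h3⟩⟩
  let G : ℤ → ℤ → Kˣ := fun p q =>
    if h0 : h p q = 0 then 1 else Units.mk0 _ h0
  have hG : ∀ p q, h p q ≠ 0 → h p q = (G p q : K) := by
    intro p q h0
    simp [G, h0]
  have hG' : ∀ p q, ¬ (p = 0 ∧ q = 0) → h p q = (G p q : K) :=
    fun p q hpq => hG p q (fun h0 => hpq (hh p q h0))
  have key := congrArg (fun z => ((Additive.toMul z : Kˣ) : K))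
    (hom_identity μ ν N hμ hν (fun p q => Additive.ofMul (G p q)))
  simp only [toMul_add, toMul_sum, Units.val_mul, Units.coe_prod, toMul_ofMul] at key
  convert key using 1
  · congr 1
    · congr 1
      · congr 1
        · exact Finset.prod_congr rfl fun n hn => Finset.prod_congr rfl fun m hm =>
            hG _ _ (h1 n hn m hm)
        · exact Finset.prod_congr rfl fun n hn => Finset.prod_congr rfl fun m hm =>
            hG' _ _ (by omega)
      · exact Finset.prod_congr rfl fun x hx => hG' _ _ (by have := hμ x hx; omega)
    · exact Finset.prod_congr rfl fun x hx => hG' _ _ (by have := hν x hx; omega)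
  · congr 1
    · congr 1
      · congr 1
        · exact Finset.prod_congr rfl fun n hn => Finset.prod_congr rfl fun m hm =>
            hG' _ _ (by omega)
        · exact Finset.prod_congr rfl fun n hn => Finset.prod_congr rfl fun m hm =>
            hG _ _ (h2 n hn m hm)
      · exact Finset.prod_congr rfl fun x hx => hG' _ _ (by have := hν x hx; omega)
    · exact Finset.prod_congr rfl fun x hx => hG' _ _ (by have := hμ x hx; omega)

lemma alg_final {K : Type*} [Field K] {S1 S2 V1 V2 p1 p2 x1 x2 x3 x4 : K} (hV : V2 ≠ 0)
    (hp1 : p1 ≠ 0) (hp2 : p2 ≠ 0) (n1 : x1 ≠ 0) (n2 : x2 ≠ 0)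
    (key : S1 * V2 * (p1 * x1) * (p2 * x2) = V1 * S2 * x3 * x4) :
    S1 = (p1 * p2)⁻¹ * (V1 * V2⁻¹ * S2) * (x3 * x4 * (x1 * x2)⁻¹) := by
  field_simp
  linear_combination key

lemma pull_y {y : F} (hy : y ≠ 0) {ι : Type*} (s : Finset ι) (f : ι → HahnSeries Γ2 F) :
    ∏ x ∈ s, f x = HahnSeries.C y ^ s.card * ∏ x ∈ s, (HahnSeries.C y⁻¹ * f x) := by
  rw [Finset.prod_mul_distrib, Finset.prod_const, ← mul_assoc, ← mul_pow, ← map_mul,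
    mul_inv_cancel₀ hy, map_one, one_pow, one_mul]

lemma pair_core (μ ν : YoungDiagram) {y κ : F} (hy : y ≠ 0) (hκ : κ ≠ 0) (d : ℤ) (hd : 1 ≤ d) :
    ∃ N₀ : ℕ, ∀ N ≥ N₀, ∃ E : HahnSeries Γ2 F, UD d E ∧
    (∏ n ∈ Finset.range N, ∏ m ∈ Finset.range N,
        gg y κ ((m : ℤ) - ν.colLen n) ((μ.rowLen m : ℤ) - n - 1)) =
    HahnSeries.C y ^ (-((μ.cells.card : ℤ) + ν.cells.card)) *
    ((∏ n ∈ Finset.range N, ∏ m ∈ Finset.range N, gg y κ n (-((m : ℤ) + 1))) *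
      (∏ n ∈ Finset.range N, ∏ m ∈ Finset.range N, gg y κ (-((n : ℤ) + 1)) m)⁻¹ *
      (∏ n ∈ Finset.range N, ∏ m ∈ Finset.range N,
        gg y κ ((μ.colLen n : ℤ) - m - 1) ((n : ℤ) - ν.rowLen m))) * E := by
  obtain ⟨M, hM⟩ := cells_bound μ
  obtain ⟨M', hM'⟩ := cells_bound ν
  refine ⟨M + M' + d.toNat, fun N hN => ?_⟩
  have hμ : ∀ x ∈ μ.cells, x.1 < N ∧ x.2 < N := fun x hx => by have := hM x hx; omega
  have hν : ∀ x ∈ ν.cells, x.1 < N ∧ x.2 < N := fun x hx => by have := hM' x hx; omega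
  have key := prod_id (gg y κ) N μ ν hμ hν
    (fun p q h0 => by rw [gg_eq_zero] at h0; exact ⟨h0.1, h0.2.1⟩)
  have hv : (∏ n ∈ Finset.range N, ∏ m ∈ Finset.range N, gg y κ (-((n : ℤ) + 1)) m) ≠ 0 := by
    refine Finset.prod_ne_zero_iff.2 fun n _ => Finset.prod_ne_zero_iff.2 fun m _ => ?_
    rw [Ne, gg_eq_zero]
    omega
  rw [pull_y hy μ.cells (fun x => gg y κ x.1 ((x.2 : ℤ) - N)),
    pull_y hy ν.cells (fun x => gg y κ ((N : ℤ) - 1 - x.1) (-1 - (x.2 : ℤ)))] at key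
  have e1 : UD d (∏ x ∈ μ.cells, (HahnSeries.C y⁻¹ * gg y κ x.1 ((x.2 : ℤ) - N))) :=
    UD.prod (by omega) _ _ fun x hx => gg_UD' y κ hy hκ _ _ d hd (by have := hM x hx; omega)
  have e2 : UD d (∏ x ∈ ν.cells,
      (HahnSeries.C y⁻¹ * gg y κ ((N : ℤ) - 1 - x.1) (-1 - (x.2 : ℤ)))) :=
    UD.prod (by omega) _ _ fun x hx => gg_UD' y κ hy hκ _ _ d hd (by have := hM' x hx; omega)
  have e3 : UD d (∏ x ∈ ν.cells, gg y κ (-1 - (x.1 : ℤ)) ((N : ℤ) - 1 - x.2)) :=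
    UD.prod (by omega) _ _ fun x hx => gg_UD y κ _ _ d hd (by have := hM' x hx; omega)
  have e4 : UD d (∏ x ∈ μ.cells, gg y κ ((x.1 : ℤ) - N) x.2) :=
    UD.prod (by omega) _ _ fun x hx => gg_UD y κ _ _ d hd (by have := hM x hx; omega)
  have hd0 : 0 ≤ d := by omega
  refine ⟨_, ((e3.mul hd0 e4).mul hd0 ((e1.mul hd0 e2).inv hd)), ?_⟩
  have n1 := e1.ne hd
  have n2 := e2.ne hd
  have hY : (HahnSeries.C y : HahnSeries Γ2 F) ≠ 0 := HahnSeries.C_ne_zero hy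
  rw [zpow_neg, zpow_add₀ hY, zpow_natCast, zpow_natCast]
  exact alg_final hv (pow_ne_zero _ hY) (pow_ne_zero _ hY) n1 n2 key
end pair

section asm
variable {F}

lemma assemble {K : Type*} [Field K] (r : ℕ) (Y O : Fin r → K) (f M D E : Fin r → Fin r → K)
    (yy : K) (hy : yy ≠ 0) (c : Fin r → ℤ) (hO : ∀ i, O i ≠ 0) (hf : ∀ i, f i i = Y i / O i)
    (hD : ∀ i, ∀ j ∈ Finset.Ioi i,
      D i j = yy ^ (-(c i + c j)) * (M i j * f j i) * E i j) :
    (∏ i, Y i) * ∏ i, ∏ j ∈ Finset.Ioi i, (f i j * D i j) =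
    (yy ^ ((1 - (r : ℤ)) * ∑ i, c i) * (∏ i, ∏ j ∈ Finset.Ioi i, M i j) * (∏ i, O i) *
      ∏ i, ∏ j, f i j) * ∏ i, ∏ j ∈ Finset.Ioi i, E i j := by
  have hoff : ∀ i, ∏ j, f j i = f i i * ∏ j ∈ ({i} : Finset (Fin r))ᶜ, f j i := by
    intro i
    rw [← Finset.prod_mul_prod_compl {i} (fun j => f j i), Finset.prod_singleton]
  have h1 : ∏ i, ∏ j, f i j = (∏ i, f i i) * ∏ i, ∏ j ∈ Finset.Ioi i, (f j i * f i j) := by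
    rw [Finset.prod_comm, Finset.prod_prod_Ioi_mul_eq_prod_prod_off_diag,
      ← Finset.prod_mul_distrib]
    exact Finset.prod_congr rfl fun i _ => hoff i
  have h2 : ∏ i, f i i = (∏ i, Y i) / ∏ i, O i := by
    rw [← Finset.prod_div_distrib]
    exact Finset.prod_congr rfl fun i _ => hf i
  have hO' : ∏ i, O i ≠ 0 := Finset.prod_ne_zero_iff.2 fun i _ => hO i
  have h3 : ∏ i, ∏ j ∈ Finset.Ioi i, yy ^ (-(c i + c j)) = yy ^ ((1 - (r : ℤ)) * ∑ i, c i) := by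
    have h4 : ∀ i j, yy ^ (-(c i + c j)) = yy ^ (-c j) * yy ^ (-c i) := by
      intro i j
      rw [← zpow_add₀ hy]
      congr 1
      ring
    simp only [h4]
    rw [Finset.prod_prod_Ioi_mul_eq_prod_prod_off_diag (fun j _ => yy ^ (-c j))]
    have h5 : ∀ i : Fin r, ∏ j ∈ ({i} : Finset (Fin r))ᶜ, yy ^ (-c j) =
        (∏ j, yy ^ (-c j)) * yy ^ (c i) := by
      intro i
      rw [← Finset.prod_mul_prod_compl {i} (fun j => yy ^ (-c j)), Finset.prod_singleton,
        mul_right_comm, ← zpow_add₀ hy, neg_add_cancel, zpow_zero, one_mul]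
    simp only [h5]
    have h6 : ∀ s : Finset (Fin r), ∀ g : Fin r → ℤ, ∏ i ∈ s, yy ^ g i = yy ^ ∑ i ∈ s, g i := by
      intro s g
      induction s using Finset.induction_on with
      | empty => simp
      | insert a s ha ih => rw [Finset.prod_insert ha, Finset.sum_insert ha, ih, zpow_add₀ hy]
    rw [Finset.prod_mul_distrib, Finset.prod_const, h6, h6, Finset.card_univ, Fintype.card_fin,
      ← zpow_natCast, ← zpow_mul, ← zpow_add₀ hy, Finset.sum_neg_distrib]
    congr 1
    ring
  have h7 : ∏ i, ∏ j ∈ Finset.Ioi i, (f i j * D i j) =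
      ∏ i, ∏ j ∈ Finset.Ioi i, ((yy ^ (-(c i + c j))) * M i j * (f j i * f i j) * E i j) := by
    refine Finset.prod_congr rfl fun i _ => Finset.prod_congr rfl fun j hj => ?_
    rw [hD i j hj]
    ring
  rw [h7, h1, h2]
  simp only [Finset.prod_mul_distrib]
  rw [h3]
  field_simp

lemma fac_a {r : ℕ} (Pa : Fin r → YoungDiagram) (e : Fin r → F) (y : F) (i j : Fin r) (n m : ℕ)
    (z : F) (Z : HahnSeries Γ2 F) (hZ : Z = HahnSeries.C z) (p q : ℤ) :
    1 - Z * mono F p q * uMon F Pa e j n * vMon F Pa e i m =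
      TT (z * (e i * (e j)⁻¹)) (p + (Pa j).colLen n - m - 1) (q + n + 1 - (Pa i).rowLen m) := by
  have : mono F (p + (Pa j).colLen n - m - 1) (q + n + 1 - (Pa i).rowLen m) =
      mono F p q * mono F ((Pa j).colLen n) (n + 1) * mono F (-(m + 1)) (-(Pa i).rowLen m) := by
    rw [mono_mul, mono_mul]
    congr 1 <;> ring
  rw [hZ, TT, this, uMon, vMon, map_mul, map_mul, map_inv₀]
  ring

lemma Mtr_ratio (K L : F) (p q : ℤ) (N : ℕ) :
    Mtr F (HahnSeries.C K * mono F p q) N / Mtr F (HahnSeries.C L * mono F p q) N =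
      ∏ n ∈ Finset.range N, ∏ m ∈ Finset.range N,
        (TT L (p - (n + 1)) (q + (m + 1)) / TT K (p - (n + 1)) (q + (m + 1))) := by
  unfold Mtr
  rw [← Finset.prod_div_distrib]
  refine Finset.prod_congr rfl fun n _ => ?_
  rw [← Finset.prod_div_distrib]
  refine Finset.prod_congr rfl fun m _ => ?_
  rw [mul_assoc, mul_assoc, mono_mul, inv_div_inv]
  rfl

/-- factors -/
def ff {r : ℕ} (Pa : Fin r → YoungDiagram) (e : Fin r → F) (y : F) (N : ℕ) (i j : Fin r) :
    HahnSeries Γ2 F :=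
  ∏ n ∈ Finset.range N, ∏ m ∈ Finset.range N,
    gg y (e i * (e j)⁻¹) (((Pa j).colLen n : ℤ) - m - 1) ((n : ℤ) - (Pa i).rowLen m)

def DD {r : ℕ} (Pa : Fin r → YoungDiagram) (e : Fin r → F) (y : F) (N : ℕ) (i j : Fin r) :
    HahnSeries Γ2 F :=
  ∏ n ∈ Finset.range N, ∏ m ∈ Finset.range N,
    TT (y⁻¹ * (e i * (e j)⁻¹)) (((Pa j).colLen n : ℤ) - m) ((n : ℤ) + 1 - (Pa i).rowLen m) /
    TT (e i * (e j)⁻¹) (((Pa j).colLen n : ℤ) - m) ((n : ℤ) + 1 - (Pa i).rowLen m)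

def YY {r : ℕ} (Pa : Fin r → YoungDiagram) (N : ℕ) (y : F) (i : Fin r) :
    HahnSeries Γ2 F :=
  ∏ n ∈ Finset.range N, ∏ m ∈ Finset.range N,
    TT y (((Pa i).colLen n : ℤ) - m - 1) ((n : ℤ) - (Pa i).rowLen m)

def MM {r : ℕ} (e : Fin r → F) (y : F) (N : ℕ) (i j : Fin r) : HahnSeries Γ2 F :=
  (∏ n ∈ Finset.range N, ∏ m ∈ Finset.range N,
    (HahnSeries.C y⁻¹ * gg y (e j * (e i)⁻¹) n (-((m : ℤ) + 1)))) *
  (∏ n ∈ Finset.range N, ∏ m ∈ Finset.range N, gg y (e j * (e i)⁻¹) (-((n : ℤ) + 1)) m)⁻¹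

lemma fac_y {r : ℕ} (Pa : Fin r → YoungDiagram) (e : Fin r → F) (y : F) (i j : Fin r) (n m : ℕ) :
    1 - HahnSeries.C y * mono F 0 (-1) * uMon F Pa e j n * vMon F Pa e i m =
      TT (y * (e i * (e j)⁻¹)) (((Pa j).colLen n : ℤ) - m - 1) ((n : ℤ) - (Pa i).rowLen m) := by
  rw [fac_a Pa e y i j n m y _ rfl]
  congr 1 <;> ring

lemma fac_1 {r : ℕ} (Pa : Fin r → YoungDiagram) (e : Fin r → F) (i j : Fin r) (n m : ℕ) :
    1 - mono F 0 (-1) * uMon F Pa e j n * vMon F Pa e i m =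
      TT (e i * (e j)⁻¹) (((Pa j).colLen n : ℤ) - m - 1) ((n : ℤ) - (Pa i).rowLen m) := by
  have := fac_y Pa e 1 i j n m
  rwa [map_one, one_mul, one_mul] at this

lemma fac_yi {r : ℕ} (Pa : Fin r → YoungDiagram) (e : Fin r → F) (y : F) (i j : Fin r) (n m : ℕ) :
    1 - (HahnSeries.C y)⁻¹ * mono F 1 0 * uMon F Pa e j n * vMon F Pa e i m =
      TT (y⁻¹ * (e i * (e j)⁻¹)) (((Pa j).colLen n : ℤ) - m)
        ((n : ℤ) + 1 - (Pa i).rowLen m) := by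
  rw [fac_a Pa e y i j n m y⁻¹ _ (map_inv₀ _ _).symm]
  congr 1 <;> ring

lemma fac_1i {r : ℕ} (Pa : Fin r → YoungDiagram) (e : Fin r → F) (i j : Fin r) (n m : ℕ) :
    1 - mono F 1 0 * uMon F Pa e j n * vMon F Pa e i m =
      TT (e i * (e j)⁻¹) (((Pa j).colLen n : ℤ) - m) ((n : ℤ) + 1 - (Pa i).rowLen m) := by
  have := fac_yi Pa e 1 i j n m
  rwa [map_one, inv_one, one_mul, inv_one, one_mul] at this

lemma lhs3_eq {r : ℕ} (Pa : Fin r → YoungDiagram) (e : Fin r → F) (he : ∀ i, e i ≠ 0) (y : F)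
    (N : ℕ) : lhs3 F Pa e y N =
      (∏ i, YY Pa N y i) * ∏ i, ∏ j ∈ Finset.Ioi i, (ff Pa e y N i j * DD Pa e y N i j) := by
  unfold lhs3 YY ff DD
  simp only [fac_y, fac_1, fac_yi, fac_1i, mul_inv_cancel₀ (he _), mul_one,
    ← Finset.prod_mul_distrib, mul_div_mul_comm, gg]

lemma rhs3_eq {r : ℕ} (Pa : Fin r → YoungDiagram) (e : Fin r → F) (he : ∀ i, e i ≠ 0) (y : F)
    (hy : y ≠ 0) (N : ℕ) : rhs3 F Pa e y N =
      HahnSeries.C y ^ ((1 - (r : ℤ)) * ∑ i : Fin r, ((Pa i).cells.card : ℤ)) *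
      (∏ i, ∏ j ∈ Finset.Ioi i, MM e y N i j) * (∏ i, YY Pa N 1 i) *
      ∏ i, ∏ j, ff Pa e y N i j := by
  have hM : ∀ i j, (Mtr F (HahnSeries.C (e i) * (HahnSeries.C (e j))⁻¹ * mono F 1 0) N /
      Mtr F ((HahnSeries.C y)⁻¹ * HahnSeries.C (e i) * (HahnSeries.C (e j))⁻¹ *
        mono F 1 0) N) *
    (Mtr F (HahnSeries.C y * HahnSeries.C (e j) * (HahnSeries.C (e i))⁻¹ *
        mono F 0 (-1)) N /
      Mtr F (HahnSeries.C (e j) * (HahnSeries.C (e i))⁻¹ * mono F 0 (-1)) N) = MM e y N i j := by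
    intro i j
    have hκ : e j * (e i)⁻¹ ≠ 0 := mul_ne_zero (he j) (inv_ne_zero (he i))
    simp only [← map_inv₀, ← map_mul]
    rw [Mtr_ratio, Mtr_ratio]
    unfold MM
    congr 1
    · refine Finset.prod_congr rfl fun n _ => Finset.prod_congr rfl fun m _ => ?_
      have h := gg_flip y (e j * (e i)⁻¹) hy hκ (-(n : ℤ)) ((m : ℤ) + 1)
      rw [neg_neg] at h
      rw [← h, mul_inv, inv_inv, mul_comm (e j)⁻¹ (e i), ← mul_assoc]
      congr 2 <;> ring
    · rw [← Finset.prod_inv_distrib]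
      refine Finset.prod_congr rfl fun n _ => ?_
      rw [← Finset.prod_inv_distrib]
      refine Finset.prod_congr rfl fun m _ => ?_
      rw [gg, inv_div, mul_assoc]
      congr 2 <;> ring
  unfold rhs3
  simp only [hM]
  unfold YY ff
  simp only [fac_y, fac_1, mul_inv_cancel₀ (he _), gg]

lemma YY_ne {r : ℕ} (Pa : Fin r → YoungDiagram) (N : ℕ) (i : Fin r) :
    YY (F := F) Pa N 1 i ≠ 0 := by
  refine Finset.prod_ne_zero_iff.2 fun n _ => Finset.prod_ne_zero_iff.2 fun m _ => ?_
  rw [Ne, TT_eq_zero]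
  rintro ⟨h1, h2, -⟩
  have h3 : (m, n) ∈ Pa i := by
    rw [YoungDiagram.mem_iff_lt_colLen]
    omega
  rw [YoungDiagram.mem_iff_lt_rowLen] at h3
  omega

lemma ff_diag {r : ℕ} (Pa : Fin r → YoungDiagram) (e : Fin r → F) (he : ∀ i, e i ≠ 0) (y : F)
    (N : ℕ) (i : Fin r) : ff Pa e y N i i = YY Pa N y i / YY Pa N 1 i := by
  unfold ff YY
  simp only [gg, mul_inv_cancel₀ (he _), mul_one, Finset.prod_div_distrib]

lemma DD_eq {r : ℕ} (Pa : Fin r → YoungDiagram) (e : Fin r → F) (he : ∀ i, e i ≠ 0) (y : F)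
    (hy : y ≠ 0) (d : ℤ) (hd : 1 ≤ d) (i j : Fin r) :
    ∃ N₀ : ℕ, ∀ N ≥ N₀, ∃ E : HahnSeries Γ2 F, UD d E ∧ DD Pa e y N i j =
      HahnSeries.C y ^ (-(((Pa i).cells.card : ℤ) + (Pa j).cells.card)) *
        (MM e y N i j * ff Pa e y N j i) * E := by
  have hκ : e j * (e i)⁻¹ ≠ 0 := mul_ne_zero (he j) (inv_ne_zero (he i))
  obtain ⟨N₀, h⟩ := pair_core (Pa i) (Pa j) hy hκ d hd
  refine ⟨N₀, fun N hN => ?_⟩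
  obtain ⟨E, hE, h⟩ := h N hN
  refine ⟨E, hE, ?_⟩
  have hD : DD Pa e y N i j = ∏ n ∈ Finset.range N, ∏ m ∈ Finset.range N,
      (HahnSeries.C y⁻¹ * gg y (e j * (e i)⁻¹) ((m : ℤ) - (Pa j).colLen n)
        (((Pa i).rowLen m : ℤ) - n - 1)) := by
    refine Finset.prod_congr rfl fun n _ => Finset.prod_congr rfl fun m _ => ?_
    have h := gg_flip y (e j * (e i)⁻¹) hy hκ (((Pa j).colLen n : ℤ) - m)
      ((n : ℤ) + 1 - (Pa i).rowLen m)
    rw [mul_inv, inv_inv, mul_comm (e j)⁻¹ (e i)] at h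
    rw [h]
    congr 2 <;> ring
  rw [hD, MM, ff]
  simp only [Finset.prod_mul_distrib]
  rw [h]
  ring

lemma lhs3_BB {r : ℕ} (Pa : Fin r → YoungDiagram) (e : Fin r → F) (he : ∀ i, e i ≠ 0) (y : F) :
    BB (fun N => lhs3 F Pa e y N) := by
  have hb : ∃ B : ℕ, ∀ i n, (Pa i).colLen n ≤ B ∧ (Pa i).rowLen n ≤ B := by
    refine ⟨∑ i, ((Pa i).colLen 0 + (Pa i).rowLen 0), fun i n => ?_⟩
    have h1 := Finset.single_le_sum (f := fun i => (Pa i).colLen 0 + (Pa i).rowLen 0)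
      (fun _ _ => Nat.zero_le _) (Finset.mem_univ i)
    have h2 := (Pa i).colLen_anti 0 n (Nat.zero_le _)
    have h3 := (Pa i).rowLen_anti 0 n (Nat.zero_le _)
    omega
  obtain ⟨B, hB⟩ := hb
  have hT : ∀ (z : F) (i j : Fin r) (n m : ℕ), 2 * B + 1 ≤ n + m →
      UD 1 (TT z (((Pa j).colLen n : ℤ) - m - 1) ((n : ℤ) - (Pa i).rowLen m)) := by
    intro z i j n m h
    have h1 := (hB j n).1
    have h2 := (hB i m).2
    exact TT_UD _ _ _ _ (by omega)
  have hT' : ∀ (z : F) (i j : Fin r) (n m : ℕ), 2 * B + 1 ≤ n + m →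
      UD 1 (TT z (((Pa j).colLen n : ℤ) - m) ((n : ℤ) + 1 - (Pa i).rowLen m)) := by
    intro z i j n m h
    have h1 := (hB j n).1
    have h2 := (hB i m).2
    exact TT_UD _ _ _ _ (by omega)
  simp only [lhs3_eq Pa e he y]
  refine BB.mul (BB.prod _ _ fun i _ => BB_dbl _ (2 * B + 1) fun n m h => hT _ _ _ _ _ h)
    (BB.prod _ _ fun i _ => BB.prod _ _ fun j _ => BB.mul
      (BB_dbl _ (2 * B + 1) fun n m h => ?_) (BB_dbl _ (2 * B + 1) fun n m h => ?_))
  · rw [gg, div_eq_mul_inv]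
    exact (hT _ _ _ _ _ h).mul zero_le_one ((hT _ _ _ _ _ h).inv le_rfl)
  · rw [div_eq_mul_inv]
    exact (hT' _ _ _ _ _ h).mul zero_le_one ((hT' _ _ _ _ _ h).inv le_rfl)

lemma final_aux {r : ℕ} (Pa : Fin r → YoungDiagram) (e : Fin r → F) (he : ∀ i, e i ≠ 0) (y : F)
    (hy : y ≠ 0) (d : ℤ) (hd : 1 ≤ d) : ∃ N₀ : ℕ, ∀ N ≥ N₀, ∃ E : HahnSeries Γ2 F, UD d E ∧
      lhs3 F Pa e y N = rhs3 F Pa e y N * E := by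
  choose N₀ h using DD_eq Pa e he y hy d hd
  refine ⟨∑ i, ∑ j, N₀ i j, fun N hN => ?_⟩
  have hN' : ∀ i j, N ≥ N₀ i j := by
    intro i j
    have h1 := Finset.single_le_sum (f := fun i => ∑ j, N₀ i j)
      (fun _ _ => Nat.zero_le _) (Finset.mem_univ i)
    have h2 := Finset.single_le_sum (f := fun j => N₀ i j)
      (fun _ _ => Nat.zero_le _) (Finset.mem_univ j)
    exact le_trans (le_trans h2 h1) hN
  choose E hE hD using fun i j => h i j N (hN' i j)
  refine ⟨∏ i, ∏ j ∈ Finset.Ioi i, E i j, UD.prod (by omega) _ _ fun i _ =>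
    UD.prod (by omega) _ _ fun j _ => hE i j, ?_⟩
  rw [lhs3_eq Pa e he, rhs3_eq Pa e he y hy]
  exact assemble r (YY Pa N y) (YY Pa N 1) (ff Pa e y N) (MM e y N) (DD Pa e y N) E
    (HahnSeries.C y) (HahnSeries.C_ne_zero hy) (fun i => ((Pa i).cells.card : ℤ))
    (YY_ne Pa N) (ff_diag Pa e he y N) (fun i j _ => hD i j)
end asm

/-- the two formal series agree (coefficientwise limits of truncations). -/
theorem statement3 (r : ℕ) (hr : 1 ≤ r) (Pa : Fin r → YoungDiagram)
    (e : Fin r → F) (he : ∀ i, e i ≠ 0) (y : F) (hy : y ≠ 0) :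
    ∀ bound : Γ2, ∃ N₀ : ℕ, ∀ N ≥ N₀, ∀ g : Γ2, g ≤ bound →
      (lhs3 F Pa e y N).coeff g = (rhs3 F Pa e y N).coeff g := by
  intro bound
  obtain ⟨c, hc⟩ := lhs3_BB Pa e he y
  obtain ⟨N₀, h⟩ := final_aux Pa e he y hy (|(ofLex bound).1| + c + 1)
    (by have := abs_nonneg (ofLex bound).1; omega)
  refine ⟨N₀, fun N hN g hg => ?_⟩
  obtain ⟨E, hE, h⟩ := h N hN
  have hd : (1 : ℤ) ≤ |(ofLex bound).1| + c + 1 := by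
    have := abs_nonneg (ofLex bound).1
    omega
  have hne := hE.ne hd
  have h1 : lhs3 F Pa e y N - rhs3 F Pa e y N = -(lhs3 F Pa e y N * (E⁻¹ - 1)) := by
    rw [h, mul_sub, mul_assoc, mul_inv_cancel₀ hne]
    ring
  have h2 := ((hc N).mul (hE.inv hd)).neg
  rw [← h1] at h2
  have h3 := h2 g (by
    have hg1 : (ofLex g).1 ≤ (ofLex bound).1 := by
      rw [Prod.Lex.le_iff] at hg
      rcases hg with hg | hg
      · exact hg.le
      · exact hg.1.le
    have := le_abs_self (ofLex bound).1
    omega)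
  rw [HahnSeries.coeff_sub, sub_eq_zero] at h3
  exact h3

end
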